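/- arXiv:1810.11740 — 4 statements merged into one kernel-verified Lean document; each statement's English description precedes it below -/
import Mathlib

section
/- Let X be a compact metric space and let d be a divergence on Borel probability measures on X (a map assigning to each ordered pair of Borel probability measures an extended real number) that is nonnegative, convex in its second argument (i.e., for each fixed P, the map Q ↦ d(P,Q) is convex along mixtures of measures), and lower semicontinuous in its second argument with respect to the topology of weak convergence of probability measures. Let F be a convex set of continuous real-valued functions on X. Then for all Borel probability measures P1, P2 on X: sup_{D∈F} ( ∫ D dP2 − d*_{P1}(D) ) = inf_Q ( d(P1,Q) + sup_{D∈F} ( ∫ D dP2 − ∫ D dQ ) ), where the infimum is over all Borel probability measures Q on X. -/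
open MeasureTheory
open scoped ENNReal NNReal

/-- The conjugate of a divergence `d` over the distribution `P`:
`d*_P(D) := sup_Q ( ∫ D dQ − d(P,Q) )`, the supremum over all Borel probability
measures `Q` on `X`. -/
noncomputable def divConj {X : Type*} [MeasurableSpace X]
    (d : ProbabilityMeasure X → ProbabilityMeasure X → EReal)
    (P : ProbabilityMeasure X) (D : X → ℝ) : EReal :=
  ⨆ Q : ProbabilityMeasure X, ((∫ x, D x ∂(Q : Measure X) : ℝ) : EReal) - d P Q

/-- A finite-dimensional minimax principle: if every point of a convex upward closed set has some
coordinate above `c`, then some fixed convex combination of the coordinates is at least `c`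
on the whole set. -/
theorem exists_weights_le_of_forall_exists_lt {ι : Type*} [Fintype ι] [Nonempty ι]
    {K : Set (ι → ℝ)} (hK : Convex ℝ K) (hK_up : IsUpperSet K) {c : ℝ}
    (h : ∀ t ∈ K, ∃ i, c < t i) :
    ∃ w : ι → ℝ, (∀ i, 0 ≤ w i) ∧ ∑ i, w i = 1 ∧ ∀ t ∈ K, c ≤ ∑ i, w i * t i := by
  classical
  obtain rfl | ⟨t₀, ht₀⟩ := K.eq_empty_or_nonempty
  · refine ⟨Pi.single (Classical.arbitrary ι) 1, fun i => ?_, by simp, by simp⟩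
    exact (Pi.single_nonneg.2 zero_le_one : (0 : ι → ℝ) ≤ _) i
  have hdisj : Disjoint (Set.pi Set.univ fun _ : ι => Set.Iio c) K := by
    rw [Set.disjoint_left]
    intro t ht htK
    obtain ⟨i, hi⟩ := h t htK
    exact lt_asymm hi (ht i trivial)
  obtain ⟨f, u, hfs, hfK⟩ := geometric_hahn_banach_open
    (convex_pi fun _ _ => convex_Iio c)
    (isOpen_set_pi Set.finite_univ fun _ _ => isOpen_Iio) hK hdisj
  set v : ι → ℝ := fun i => f (Pi.single i 1) with hv
  have hf : ∀ t, f t = ∑ i, v i * t i := by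
    intro t
    conv_lhs => rw [← Finset.univ_sum_single t]
    rw [map_sum]
    refine Finset.sum_congr rfl fun i _ => ?_
    have : (Pi.single i (t i) : ι → ℝ) = t i • Pi.single i 1 := by
      rw [← Pi.single_smul]; simp
    rw [this, map_smul, smul_eq_mul, mul_comm]
  have hv_nonneg : ∀ i, 0 ≤ v i := by
    intro i
    by_contra! hneg
    have hn : 0 ≤ (f t₀ - u + 1) / (-v i) :=
      div_nonneg (by linarith [hfK t₀ ht₀]) (by linarith)
    have hmem : t₀ + ((f t₀ - u + 1) / (-v i)) • Pi.single i (1 : ℝ) ∈ K := by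
      refine hK_up (le_add_of_nonneg_right (smul_nonneg hn ?_)) ht₀
      exact Pi.single_nonneg.2 zero_le_one
    have h1 := hfK _ hmem
    have h2 : (f t₀ - u + 1) / (-v i) * v i = -(f t₀ - u + 1) := by
      field_simp [hneg.ne]
    rw [map_add, map_smul, smul_eq_mul] at h1
    change u ≤ f t₀ + (f t₀ - u + 1) / (-v i) * v i at h1
    linarith
  have hconst : ∀ x < c, x * ∑ i, v i < u := by
    intro x hx
    have := hfs (fun _ => x) fun _ _ => hx
    rwa [hf, ← Finset.sum_mul, mul_comm] at this
  have hsum_pos : 0 < ∑ i, v i := by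
    refine lt_of_le_of_ne (Finset.sum_nonneg fun i _ => hv_nonneg i) fun h0 => ?_
    have hzero : ∀ i, v i = 0 := fun i =>
      (Finset.sum_eq_zero_iff_of_nonneg fun i _ => hv_nonneg i).1 h0.symm i (Finset.mem_univ i)
    have h1 := hconst (c - 1) (by linarith)
    have h2 := hfK t₀ ht₀
    rw [hf] at h2
    simp only [hzero, zero_mul, Finset.sum_const_zero, mul_zero] at h1 h2
    linarith
  have hcu : c * ∑ i, v i ≤ u := by
    rw [← le_div_iff₀ hsum_pos]
    refine le_of_forall_lt fun x hx => ?_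
    exact (lt_div_iff₀ hsum_pos).2 (hconst x hx)
  refine ⟨fun i => v i / ∑ j, v j, fun i => div_nonneg (hv_nonneg i) hsum_pos.le, ?_, ?_⟩
  · rw [← Finset.sum_div, div_self hsum_pos.ne']
  · intro t ht
    have h1 : ∑ i, v i / (∑ j, v j) * t i = (∑ i, v i * t i) / ∑ j, v j := by
      rw [Finset.sum_div]
      exact Finset.sum_congr rfl fun i _ => div_mul_eq_mul_div _ _ _
    rw [h1, le_div_iff₀ hsum_pos, ← hf]
    exact hcu.trans (hfK t ht)

section CompactSpace

variable {X : Type*} [TopologicalSpace X] [CompactSpace X] [MeasurableSpace X] [BorelSpace X]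

theorem ContinuousMap.integrable_of_compactSpace (D : C(X, ℝ)) (μ : Measure X)
    [IsFiniteMeasure μ] : Integrable D μ :=
  D.continuous.integrable_of_hasCompactSupport (HasCompactSupport.of_compactSpace _)

theorem integral_sum_smul_continuousMap {ι : Type*} [Fintype ι] (w : ι → ℝ) (D : ι → C(X, ℝ))
    (μ : Measure X) [IsFiniteMeasure μ] :
    ∫ x, (∑ i, w i • D i) x ∂μ = ∑ i, w i * ∫ x, D i x ∂μ := by
  simp only [ContinuousMap.coe_sum, ContinuousMap.coe_smul, Finset.sum_apply, Pi.smul_apply,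
    smul_eq_mul]
  rw [integral_finsetSum _ fun i _ => ((D i).integrable_of_compactSpace μ).const_mul (w i)]
  simp only [integral_const_mul]

theorem MeasureTheory.ProbabilityMeasure.exists_convexCombination (Q₁ Q₂ : ProbabilityMeasure X)
    {a b : ℝ≥0} (hab : a + b = 1) :
    ∃ Q : ProbabilityMeasure X,
      (Q : Measure X) = (a : ℝ≥0∞) • (Q₁ : Measure X) + (b : ℝ≥0∞) • (Q₂ : Measure X) ∧
      ∀ D : C(X, ℝ), ∫ x, D x ∂(Q : Measure X) =
        a * ∫ x, D x ∂(Q₁ : Measure X) + b * ∫ x, D x ∂(Q₂ : Measure X) := by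
  have hprob : IsProbabilityMeasure
      ((a : ℝ≥0∞) • (Q₁ : Measure X) + (b : ℝ≥0∞) • (Q₂ : Measure X)) := by
    constructor
    simp only [Measure.coe_add, Measure.coe_smul, Pi.add_apply, Pi.smul_apply, measure_univ,
      smul_eq_mul, mul_one]
    exact_mod_cast hab
  refine ⟨⟨_, hprob⟩, rfl, fun D => ?_⟩
  rw [ProbabilityMeasure.coe_mk, integral_add_measure, integral_smul_measure,
    integral_smul_measure]
  · simp
  · exact (D.integrable_of_compactSpace _).smul_measure ENNReal.coe_ne_top
  · exact (D.integrable_of_compactSpace _).smul_measure ENNReal.coe_ne_top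

end CompactSpace

/-- For convex `φ`, the set of families bounding `φ Q + (p i - ∫ D i dQ)` from above for some `Q`
is convex. -/
theorem convex_setOf_upperBounds {X ι : Type*} [TopologicalSpace X] [CompactSpace X]
    [MeasurableSpace X] [BorelSpace X] {φ : ProbabilityMeasure X → EReal}
    (hφ : ∀ (Q₁ Q₂ Q : ProbabilityMeasure X) (a b : ℝ≥0), a + b = 1 →
      (Q : Measure X) = (a : ℝ≥0∞) • (Q₁ : Measure X) + (b : ℝ≥0∞) • (Q₂ : Measure X) →
      φ Q ≤ ((a : ℝ) : EReal) * φ Q₁ + ((b : ℝ) : EReal) * φ Q₂)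
    (D : ι → C(X, ℝ)) (p : ι → ℝ) :
    Convex ℝ {t : ι → ℝ | ∃ (Q : ProbabilityMeasure X) (r : ℝ), φ Q ≤ r ∧
      ∀ i, r + (p i - ∫ x, D i x ∂(Q : Measure X)) ≤ t i} := by
  rintro t₁ ⟨Q₁, r₁, hr₁, ht₁⟩ t₂ ⟨Q₂, r₂, hr₂, ht₂⟩ a b ha hb hab
  lift a to ℝ≥0 using ha
  lift b to ℝ≥0 using hb
  have hab' : a + b = 1 := by exact_mod_cast hab
  obtain ⟨Q, hQ, hQD⟩ := ProbabilityMeasure.exists_convexCombination Q₁ Q₂ hab'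
  refine ⟨Q, a * r₁ + b * r₂, (hφ Q₁ Q₂ Q a b hab' hQ).trans ?_, fun i => ?_⟩
  · push_cast
    have ha : (0 : EReal) ≤ ((a : ℝ) : EReal) := by exact_mod_cast a.2
    have hb : (0 : EReal) ≤ ((b : ℝ) : EReal) := by exact_mod_cast b.2
    gcongr
  · rw [hQD]
    simp only [Pi.add_apply, Pi.smul_apply, smul_eq_mul]
    have h1 := mul_le_mul_of_nonneg_left (ht₁ i) a.2
    have h2 := mul_le_mul_of_nonneg_left (ht₂ i) b.2
    have h3 : p i = a * p i + b * p i := by rw [← add_mul, hab, one_mul]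
    simp only [NNReal.val_eq_coe] at h1 h2
    linarith

theorem stmt0 {X : Type*} [MetricSpace X] [CompactSpace X]
    [MeasurableSpace X] [BorelSpace X]
    (d : ProbabilityMeasure X → ProbabilityMeasure X → EReal)
    (hd_nonneg : ∀ P Q, 0 ≤ d P Q)
    (hd_convex : ∀ (P Q₁ Q₂ Q : ProbabilityMeasure X) (a b : ℝ≥0), a + b = 1 →
      (Q : Measure X) = (a : ℝ≥0∞) • (Q₁ : Measure X) + (b : ℝ≥0∞) • (Q₂ : Measure X) →
      d P Q ≤ ((a : ℝ) : EReal) * d P Q₁ + ((b : ℝ) : EReal) * d P Q₂)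
    (hd_lsc : ∀ P, LowerSemicontinuous (fun Q => d P Q))
    (F : Set C(X, ℝ)) (hF : Convex ℝ F)
    (P₁ P₂ : ProbabilityMeasure X) :
    (⨆ D ∈ F, (((∫ x, D x ∂(P₂ : Measure X)) : ℝ) : EReal) - divConj d P₁ (⇑D)) =
      ⨅ Q : ProbabilityMeasure X,
        (d P₁ Q + ⨆ D ∈ F, ((((∫ x, D x ∂(P₂ : Measure X)) : ℝ) : EReal) -
          (((∫ x, D x ∂(Q : Measure X)) : ℝ) : EReal))) := by
  apply le_antisymm
  · refine iSup₂_le fun D hD => le_iInf fun Q => ?_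
    calc _ ≤ ((∫ x, D x ∂(P₂ : Measure X) : ℝ) : EReal) -
          (((∫ x, D x ∂(Q : Measure X) : ℝ) : EReal) - d P₁ Q) :=
          EReal.sub_le_sub le_rfl (le_iSup
            (fun Q : ProbabilityMeasure X =>
              ((∫ x, D x ∂(Q : Measure X) : ℝ) : EReal) - d P₁ Q) Q)
      _ ≤ d P₁ Q + (((∫ x, D x ∂(P₂ : Measure X) : ℝ) : EReal) -
          ((∫ x, D x ∂(Q : Measure X) : ℝ) : EReal)) := by
          have hpos := hd_nonneg P₁ Q
          generalize d P₁ Q = y at hpos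
          induction y with
          | bot => simp at hpos
          | coe r => norm_cast; linarith
          | top => rw [← EReal.coe_sub, EReal.top_add_coe]; exact le_top
      _ ≤ _ := by
          gcongr
          exact le_iSup₂ (f := fun (D : C(X, ℝ)) (_ : D ∈ F) =>
            ((∫ x, D x ∂(P₂ : Measure X) : ℝ) : EReal) -
              ((∫ x, D x ∂(Q : Measure X) : ℝ) : EReal)) D hD
  · refine EReal.ge_of_forall_gt_iff_ge.1 fun c hc => ?_
    have hex : ∀ Q : ProbabilityMeasure X, ∃ D ∈ F,
        ((c - (∫ x, D x ∂(P₂ : Measure X) - ∫ x, D x ∂(Q : Measure X)) : ℝ) : EReal)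
          < d P₁ Q := by
      intro Q
      by_contra! hle
      refine absurd (hc.trans_le (iInf_le _ Q)) (not_lt.2 ?_)
      have hpos := hd_nonneg P₁ Q
      generalize d P₁ Q = y at hpos hle
      induction y with
      | bot => simp at hpos
      | top =>
        have hF_empty : F = ∅ := Set.eq_empty_of_forall_notMem fun D hD =>
          (EReal.coe_lt_top _).not_ge (hle D hD)
        simp [hF_empty]
      | coe r =>
        have hsup : (⨆ D ∈ F, (((∫ x, D x ∂(P₂ : Measure X) : ℝ) : EReal) -
            ((∫ x, D x ∂(Q : Measure X) : ℝ) : EReal))) ≤ ((c - r : ℝ) : EReal) := by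
          refine iSup₂_le fun D hD => ?_
          have := hle D hD
          norm_cast at this ⊢
          linarith
        calc _ ≤ (r : EReal) + ((c - r : ℝ) : EReal) := by gcongr
          _ = c := by norm_cast; ring
    choose D hDF hD using hex
    have hnhds : ∀ Q₀ : ProbabilityMeasure X, {Q : ProbabilityMeasure X |
        ((c - (∫ x, D Q₀ x ∂(P₂ : Measure X) - ∫ x, D Q₀ x ∂(Q : Measure X)) : ℝ) : EReal)
          < d P₁ Q} ∈ nhds Q₀ := by
      intro Q₀
      obtain ⟨m, hm₁, hm₂⟩ := EReal.lt_iff_exists_real_btwn.1 (hD Q₀)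
      have hcont : Continuous fun Q : ProbabilityMeasure X =>
          c - (∫ x, D Q₀ x ∂(P₂ : Measure X) - ∫ x, D Q₀ x ∂(Q : Measure X)) :=
        continuous_const.sub (continuous_const.sub
          (ProbabilityMeasure.continuous_integral_continuousMap (D Q₀)))
      filter_upwards [hcont.continuousAt.eventually_lt_const (EReal.coe_lt_coe_iff.1 hm₁),
        hd_lsc P₁ Q₀ m hm₂] with Q h₁ h₂
      exact (EReal.coe_lt_coe_iff.2 h₁).trans h₂
    obtain ⟨s, -, hs⟩ := isCompact_univ.elim_nhds_subcover _ fun Q _ => hnhds Q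
    have hcover : ∀ Q : ProbabilityMeasure X, ∃ i : s,
        ((c - (∫ x, D i x ∂(P₂ : Measure X) - ∫ x, D i x ∂(Q : Measure X)) : ℝ) : EReal)
          < d P₁ Q := by
      intro Q
      obtain ⟨i, hi, hQ⟩ := Set.mem_iUnion₂.1 (hs (Set.mem_univ Q))
      exact ⟨⟨i, hi⟩, hQ⟩
    have : Nonempty s := (hcover P₁).nonempty
    obtain ⟨w, hw, hw_sum, hwK⟩ := exists_weights_le_of_forall_exists_lt (c := c)
      (convex_setOf_upperBounds (hd_convex P₁) (fun i : s => D i)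
        fun i => ∫ x, D i x ∂(P₂ : Measure X))
      (by
        rintro t t' htt' ⟨Q, r, hr, ht⟩
        exact ⟨Q, r, hr, fun i => (ht i).trans (htt' i)⟩)
      (by
        rintro t ⟨Q, r, hr, ht⟩
        obtain ⟨i, hi⟩ := hcover Q
        refine ⟨i, ?_⟩
        have h₁ := EReal.coe_lt_coe_iff.1 (hi.trans_le hr)
        have h₂ := ht i
        linarith)
    set E : C(X, ℝ) := ∑ i, w i • D i with hE
    have hEF : E ∈ F := hF.sum_mem (fun i _ => hw i) hw_sum fun i _ => hDF i
    refine le_trans ?_ (le_iSup₂ E hEF)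
    have hconj : divConj d P₁ E ≤ ((∫ x, E x ∂(P₂ : Measure X) - c : ℝ) : EReal) := by
      refine iSup_le fun Q => ?_
      have hpos := hd_nonneg P₁ Q
      have hmem : ∀ r : ℝ, d P₁ Q = r →
          c ≤ r + (∫ x, E x ∂(P₂ : Measure X) - ∫ x, E x ∂(Q : Measure X)) := by
        intro r hr
        refine (hwK _ ⟨Q, r, hr.le, fun i => le_rfl⟩).trans_eq ?_
        rw [hE, integral_sum_smul_continuousMap, integral_sum_smul_continuousMap]
        simp only [mul_add, mul_sub, Finset.sum_add_distrib, Finset.sum_sub_distrib,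
          ← Finset.sum_mul, hw_sum, one_mul]
      generalize d P₁ Q = y at hpos hmem
      induction y with
      | bot => simp at hpos
      | top => simp
      | coe r =>
        have := hmem r rfl
        norm_cast
        linarith
    calc (c : EReal) = ((∫ x, E x ∂(P₂ : Measure X) : ℝ) : EReal) -
          ((∫ x, E x ∂(P₂ : Measure X) - c : ℝ) : EReal) := by norm_cast; ring
      _ ≤ _ := EReal.sub_le_sub le_rfl hconj
end

section
/- Let X be a compact metric space and let d be a divergence on Borel probability measures on X that is nonnegative, convex in its second argument, and lower semicontinuous in its second argument with respect to the topology of weak convergence of probability measures. Let F be a linear subspace of the space of continuous real-valued functions on X (i.e., D1, D2 ∈ F and λ ∈ ℝ imply D1 + λ·D2 ∈ F). Then for all Borel probability measures P1, P2 on X: sup_{D∈F} ( ∫ D dP2 − d*_{P1}(D) ) = inf_{Q ∈ P_F(P2)} d(P1,Q). -/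
open MeasureTheory
open scoped ENNReal NNReal

namespace MeasureTheory.ProbabilityMeasure

variable {X : Type*} [MetricSpace X] [CompactSpace X] [MeasurableSpace X] [BorelSpace X]

lemma integrable_continuousMap (Q : ProbabilityMeasure X) (D : C(X, ℝ)) :
    Integrable D (Q : Measure X) :=
  D.continuous.integrable_of_hasCompactSupport (HasCompactSupport.of_compactSpace _)

/-- Integration against `Q`, as a linear functional on a space of continuous functions. -/
noncomputable def integralOn (F : Submodule ℝ C(X, ℝ)) (Q : ProbabilityMeasure X) : F →ₗ[ℝ] ℝ where
  toFun D := ∫ x, (D : C(X, ℝ)) x ∂(Q : Measure X)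
  map_add' D₁ D₂ := by
    simpa using integral_add (Q.integrable_continuousMap D₁) (Q.integrable_continuousMap D₂)
  map_smul' c D := by
    simpa using integral_const_mul c _

lemma integralOn_apply (F : Submodule ℝ C(X, ℝ)) (Q : ProbabilityMeasure X) (D : F) :
    integralOn F Q D = ∫ x, (D : C(X, ℝ)) x ∂(Q : Measure X) := rfl

/-- The dual of `F` with the topology of pointwise convergence. -/
abbrev PointwiseDual (F : Submodule ℝ C(X, ℝ)) : Type _ :=
  WeakBilin (LinearMap.id : (F →ₗ[ℝ] ℝ) →ₗ[ℝ] F →ₗ[ℝ] ℝ)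

/-- `integralOn F Q` as a point of `PointwiseDual F`. -/
noncomputable def moment (F : Submodule ℝ C(X, ℝ)) (Q : ProbabilityMeasure X) : PointwiseDual F :=
  integralOn F Q

/-- The epigraph of `f`, pushed forward along `Q ↦ moment F Q`. -/
def momentEpigraph (F : Submodule ℝ C(X, ℝ)) (f : ProbabilityMeasure X → EReal) :
    Set (PointwiseDual F × ℝ) :=
  {p | ∃ Q, moment F Q = p.1 ∧ f Q ≤ (p.2 : EReal)}

lemma isClosed_momentEpigraph (F : Submodule ℝ C(X, ℝ)) {f : ProbabilityMeasure X → EReal}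
    (hf : LowerSemicontinuous f) : IsClosed (momentEpigraph F f) := by
  have hgraph : IsClosed {q : ProbabilityMeasure X × (PointwiseDual F × ℝ) |
      (∀ D : F, integralOn F q.1 D =
        (LinearMap.id : (F →ₗ[ℝ] ℝ) →ₗ[ℝ] F →ₗ[ℝ] ℝ) q.2.1 D) ∧ f q.1 ≤ (q.2.2 : EReal)} := by
    refine IsClosed.inter (?_ : IsClosed {q | _}) (?_ : IsClosed {q | _})
    · rw [Set.ofPred_forall]
      refine isClosed_iInter fun D => isClosed_eq ?_ ?_
      · exact (continuous_integral_continuousMap (D : C(X, ℝ))).comp continuous_fst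
      · exact (WeakBilin.eval_continuous _ D).comp (continuous_fst.comp continuous_snd)
    · exact hf.isClosed_epigraph.preimage (continuous_fst.prodMk
        (continuous_coe_real_ereal.comp (continuous_snd.comp continuous_snd)))
  convert isClosedMap_snd_of_compactSpace _ hgraph using 1
  ext p
  constructor
  · rintro ⟨Q, h, hQ⟩
    exact ⟨(Q, p), ⟨fun D => LinearMap.congr_fun h D, hQ⟩, rfl⟩
  · rintro ⟨⟨Q, p'⟩, ⟨h, hQ⟩, rfl⟩
    exact ⟨Q, LinearMap.ext h, hQ⟩

lemma convex_momentEpigraph (F : Submodule ℝ C(X, ℝ)) {f : ProbabilityMeasure X → EReal}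
    (hf : ∀ (Q₁ Q₂ Q : ProbabilityMeasure X) (a b : ℝ≥0), a + b = 1 →
      (Q : Measure X) = (a : ℝ≥0∞) • (Q₁ : Measure X) + (b : ℝ≥0∞) • (Q₂ : Measure X) →
      f Q ≤ ((a : ℝ) : EReal) * f Q₁ + ((b : ℝ) : EReal) * f Q₂) :
    Convex ℝ (momentEpigraph F f) := by
  rintro ⟨x₁, t₁⟩ ⟨Q₁, hx₁, ht₁⟩ ⟨x₂, t₂⟩ ⟨Q₂, hx₂, ht₂⟩ a b ha hb hab
  lift a to ℝ≥0 using ha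
  lift b to ℝ≥0 using hb
  have hab' : a + b = 1 := by exact_mod_cast hab
  have hprob : IsProbabilityMeasure
      ((a : ℝ≥0∞) • (Q₁ : Measure X) + (b : ℝ≥0∞) • (Q₂ : Measure X)) :=
    ⟨by simpa using mod_cast hab'⟩
  refine ⟨⟨_, hprob⟩, ?_, ?_⟩
  · subst hx₁ hx₂
    refine LinearMap.ext fun D => ?_
    change ∫ x, (D : C(X, ℝ)) x ∂_ = a * integralOn F Q₁ D + b * integralOn F Q₂ D
    rw [coe_mk, integral_add_measure
      ((Q₁.integrable_continuousMap D).smul_measure ENNReal.coe_ne_top)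
      ((Q₂.integrable_continuousMap D).smul_measure ENNReal.coe_ne_top),
      integral_smul_measure, integral_smul_measure]
    simp [integralOn_apply]
  · refine (hf Q₁ Q₂ _ a b hab' rfl).trans ?_
    have key : ((a : ℝ) : EReal) * t₁ + ((b : ℝ) : EReal) * t₂ = ((a * t₁ + b * t₂ : ℝ) : EReal) := by
      push_cast; rfl
    change _ ≤ ((a * t₁ + b * t₂ : ℝ) : EReal)
    rw [← key]
    gcongr

/-- A continuous functional on `PointwiseDual F × ℝ` is given by an element of `F` and a slope. -/
lemma exists_repr_strongDual (F : Submodule ℝ C(X, ℝ)) (g : StrongDual ℝ (PointwiseDual F × ℝ)) :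
    ∃ (D : F) (s : ℝ), ∀ (Q : ProbabilityMeasure X) (t : ℝ),
      g (moment F Q, t) = integralOn F Q D + s * t := by
  obtain ⟨D, hD⟩ := LinearMap.dualEmbedding_surjective
    (LinearMap.id : (F →ₗ[ℝ] ℝ) →ₗ[ℝ] F →ₗ[ℝ] ℝ) (g.comp (ContinuousLinearMap.inl ℝ _ ℝ))
  refine ⟨D, g (0, 1), fun Q t => ?_⟩
  have h₁ : integralOn F Q D = g (moment F Q, 0) :=
    DFunLike.congr_fun hD (moment F Q)
  have h₂ : ((moment F Q, t) : PointwiseDual F × ℝ) =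
      (moment F Q, 0) + t • ((0 : PointwiseDual F), (1 : ℝ)) := by
    simp
  rw [h₁, h₂, map_add, map_smul, smul_eq_mul, mul_comm]

/-- A nonnegative convex lower semicontinuous function exceeding `r` wherever the moments along `F`
agree with those of `P` has an affine minorant with slope in `F` and value `r` at `P`. -/
lemma exists_affine_minorant (F : Submodule ℝ C(X, ℝ)) {f : ProbabilityMeasure X → EReal}
    (hf_nonneg : ∀ Q, 0 ≤ f Q)
    (hf_convex : ∀ (Q₁ Q₂ Q : ProbabilityMeasure X) (a b : ℝ≥0), a + b = 1 →
      (Q : Measure X) = (a : ℝ≥0∞) • (Q₁ : Measure X) + (b : ℝ≥0∞) • (Q₂ : Measure X) →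
      f Q ≤ ((a : ℝ) : EReal) * f Q₁ + ((b : ℝ) : EReal) * f Q₂)
    (hf_lsc : LowerSemicontinuous f) (P : ProbabilityMeasure X) (r : ℝ)
    (hr : ∀ Q, integralOn F Q = integralOn F P → (r : EReal) < f Q) :
    ∃ D : F, ∀ (Q : ProbabilityMeasure X) (t : ℝ), f Q ≤ t →
      r ≤ integralOn F P D - integralOn F Q D + t := by
  have hnotMem : (moment F P, r) ∉ momentEpigraph F f :=
    fun ⟨Q, hQ, hle⟩ => (hr Q hQ).not_ge hle
  obtain ⟨g, u, hu, hg⟩ := geometric_hahn_banach_point_closed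
    (convex_momentEpigraph F hf_convex) (isClosed_momentEpigraph F hf_lsc) hnotMem
  obtain ⟨D, s, hDs⟩ := exists_repr_strongDual F g
  rw [hDs] at hu
  have hsep : ∀ Q (t : ℝ), f Q ≤ t → u < integralOn F Q D + s * t := fun Q t hQ => by
    rw [← hDs]
    exact hg _ ⟨Q, rfl, hQ⟩
  by_cases hne : ∃ Q, ∃ t : ℝ, f Q ≤ t
  swap
  · exact ⟨0, fun Q t hQ => (hne ⟨Q, t, hQ⟩).elim⟩
  obtain ⟨Q₀, t₀, h₀⟩ := hne
  have hs : 0 ≤ s := by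
    by_contra! hs
    have h := hsep Q₀ (max t₀ ((u - integralOn F Q₀ D) / s))
      (h₀.trans (by exact_mod_cast le_max_left _ _))
    have h' := mul_le_mul_of_nonpos_left (le_max_right t₀ ((u - integralOn F Q₀ D) / s)) hs.le
    rw [mul_div_cancel₀ _ hs.ne] at h'
    linarith
  rcases hs.eq_or_lt with rfl | hs
  · simp only [zero_mul, add_zero] at hu hsep
    refine ⟨-(|r| / (u - integralOn F P D)) • D, fun Q t hQ => ?_⟩
    have ht : 0 ≤ t := by exact_mod_cast (hf_nonneg Q).trans hQ
    have hε : 0 < u - integralOn F P D := sub_pos.2 hu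
    have h := mul_le_mul_of_nonneg_left (sub_le_sub_right (hsep Q t hQ).le (integralOn F P D))
      (div_nonneg (abs_nonneg r) hε.le)
    rw [div_mul_cancel₀ _ hε.ne'] at h
    simp only [map_smul, smul_eq_mul]
    linarith [le_abs_self r]
  · refine ⟨-s⁻¹ • D, fun Q t hQ => ?_⟩
    have h := mul_le_mul_of_nonneg_left (hu.trans (hsep Q t hQ)).le (inv_nonneg.2 hs.le)
    rw [mul_add, mul_add, inv_mul_cancel_left₀ hs.ne', inv_mul_cancel_left₀ hs.ne'] at h
    simp only [map_smul, smul_eq_mul]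
    linarith

end MeasureTheory.ProbabilityMeasure

theorem stmt1 {X : Type*} [MetricSpace X] [CompactSpace X]
    [MeasurableSpace X] [BorelSpace X]
    (d : ProbabilityMeasure X → ProbabilityMeasure X → EReal)
    (hd_nonneg : ∀ P Q, 0 ≤ d P Q)
    (hd_convex : ∀ (P Q₁ Q₂ Q : ProbabilityMeasure X) (a b : ℝ≥0), a + b = 1 →
      (Q : Measure X) = (a : ℝ≥0∞) • (Q₁ : Measure X) + (b : ℝ≥0∞) • (Q₂ : Measure X) →
      d P Q ≤ ((a : ℝ) : EReal) * d P Q₁ + ((b : ℝ) : EReal) * d P Q₂)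
    (hd_lsc : ∀ P, LowerSemicontinuous (fun Q => d P Q))
    (F : Submodule ℝ C(X, ℝ))
    (P₁ P₂ : ProbabilityMeasure X) :
    (⨆ D ∈ F, (((∫ x, D x ∂(P₂ : Measure X)) : ℝ) : EReal) - divConj d P₁ (⇑D)) =
      ⨅ (Q : ProbabilityMeasure X)
        (_ : ∀ D ∈ F, ∫ x, D x ∂(Q : Measure X) = ∫ x, D x ∂(P₂ : Measure X)),
        d P₁ Q := by
  apply le_antisymm
  · refine iSup₂_le fun D hD => le_iInf₂ fun Q hQ => ?_
    have h : ((∫ x, D x ∂(Q : Measure X) : ℝ) : EReal) - d P₁ Q ≤ divConj d P₁ D :=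
      le_iSup (fun Q : ProbabilityMeasure X =>
        ((∫ x, D x ∂(Q : Measure X) : ℝ) : EReal) - d P₁ Q) Q
    rw [← hQ D hD]
    refine (EReal.sub_le_sub le_rfl h).trans ?_
    induction hdQ : d P₁ Q with
    | bot => simp
    | top => exact le_top
    | coe t => norm_cast; linarith
  · refine EReal.ge_of_forall_gt_iff_ge.1 fun r hr => ?_
    obtain ⟨D, hD⟩ := ProbabilityMeasure.exists_affine_minorant F (hd_nonneg P₁) (hd_convex P₁)
      (hd_lsc P₁) P₂ r fun Q hQ => hr.trans_le <|
        iInf₂_le Q fun D hD => LinearMap.congr_fun hQ ⟨D, hD⟩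
    refine le_iSup₂_of_le (D : C(X, ℝ)) D.2 ?_
    have hconj : divConj d P₁ (D : C(X, ℝ)) ≤
        ((∫ x, (D : C(X, ℝ)) x ∂(P₂ : Measure X) - r : ℝ) : EReal) := by
      refine iSup_le fun Q => ?_
      induction hdQ : d P₁ Q with
      | bot => simpa [hdQ] using hd_nonneg P₁ Q
      | top => simp
      | coe t =>
        have h := hD Q t hdQ.le
        simp only [ProbabilityMeasure.integralOn_apply] at h
        norm_cast
        linarith
    refine le_trans ?_ (EReal.sub_le_sub le_rfl hconj)
    norm_cast
    linarith
end

section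
/- Let X be a compact subset of a normed vector space and let F be a convex set of 1-Lipschitz continuous functions X → ℝ. Then for all Borel probability measures P1, P2 on X: inf_Q ( W1(P1,Q) + sup_{D∈F} ( ∫ D dP2 − ∫ D dQ ) ) = sup_{D∈F} ( ∫ D dP2 − ∫ D dP1 ), where the infimum is over all Borel probability measures Q on X. -/
open MeasureTheory
open scoped ENNReal NNReal

/-- Optimal transport cost `OT_c(P,Q) := inf over couplings M of ∫ c dM`. -/
noncomputable def OTCost {X : Type*} [MeasurableSpace X]
    (c : X → X → ℝ) (P Q : ProbabilityMeasure X) : ℝ≥0∞ :=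
  ⨅ (M : ProbabilityMeasure (X × X)) (_ :
      (M : Measure (X × X)).map Prod.fst = (P : Measure X) ∧
      (M : Measure (X × X)).map Prod.snd = (Q : Measure X)),
    ∫⁻ p, ENNReal.ofReal (c p.1 p.2) ∂(M : Measure (X × X))

/-- First-order Wasserstein cost on a subset of a normed space. -/
noncomputable def W1 {E : Type*} [NormedAddCommGroup E] [MeasurableSpace E]
    {S : Set E} (P Q : ProbabilityMeasure S) : ℝ≥0∞ :=
  OTCost (fun x x' : S => ‖(x : E) - (x' : E)‖) P Q

/-- The transport cost from a measure to itself vanishes when the cost vanishes on the diagonal. -/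
lemma OTCost_self {X : Type*} [MeasurableSpace X] {c : X → X → ℝ} (hc : ∀ x, c x x = 0)
    (P : ProbabilityMeasure X) : OTCost c P P = 0 := by
  have hd : Measurable (fun x : X => (x, x)) := measurable_id.prodMk measurable_id
  refine le_antisymm ?_ bot_le
  refine iInf₂_le_of_le (P.map hd.aemeasurable) ⟨?_, ?_⟩ ?_
  · rw [ProbabilityMeasure.toMeasure_map, Measure.map_map measurable_fst hd]
    exact Measure.map_id
  · rw [ProbabilityMeasure.toMeasure_map, Measure.map_map measurable_snd hd]
    exact Measure.map_id
  · rw [ProbabilityMeasure.toMeasure_map]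
    refine (lintegral_map_le _ _).trans ?_
    simp [hc]

/-- Weak Kantorovich duality: if `|D y - D x|` is bounded by the cost `c x y`,
then the difference of the integrals of `D` is bounded by the transport cost. -/
lemma ofReal_integral_sub_le_OTCost {X : Type*} [MeasurableSpace X] {c : X → X → ℝ} {D : X → ℝ}
    (hD : ∀ x y, |D y - D x| ≤ c x y) {P Q : ProbabilityMeasure X}
    (hP : Integrable D (P : Measure X)) (hQ : Integrable D (Q : Measure X)) :
    ENNReal.ofReal ((∫ x, D x ∂(Q : Measure X)) - ∫ x, D x ∂(P : Measure X)) ≤ OTCost c P Q := by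
  refine le_iInf₂ fun M ⟨h₁, h₂⟩ => ?_
  rw [← h₁] at hP ⊢
  rw [← h₂] at hQ ⊢
  rw [integral_map measurable_fst.aemeasurable hP.aestronglyMeasurable,
    integral_map measurable_snd.aemeasurable hQ.aestronglyMeasurable,
    ← integral_sub (f := fun p : X × X => D p.2) (g := fun p : X × X => D p.1)
      (hQ.comp_measurable measurable_snd) (hP.comp_measurable measurable_fst)]
  calc _ ≤ ‖∫ p : X × X, (D p.2 - D p.1) ∂(M : Measure (X × X))‖ₑ := by
        rw [← ofReal_norm]
        exact ENNReal.ofReal_le_ofReal (le_abs_self _)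
    _ ≤ ∫⁻ p : X × X, ‖D p.2 - D p.1‖ₑ ∂(M : Measure (X × X)) :=
        enorm_integral_le_lintegral_enorm _
    _ ≤ _ := by
        refine lintegral_mono fun p => ?_
        rw [← ofReal_norm]
        exact ENNReal.ofReal_le_ofReal (hD p.1 p.2)

theorem stmt7 {E : Type*} [NormedAddCommGroup E] [NormedSpace ℝ E]
    [MeasurableSpace E] [BorelSpace E]
    (S : Set E) (hS : IsCompact S)
    (F : Set C(S, ℝ)) (hF : Convex ℝ F)
    (hFlip : ∀ D ∈ F, LipschitzWith 1 (⇑D))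
    (P₁ P₂ : ProbabilityMeasure S) :
    (⨅ Q : ProbabilityMeasure S,
      ((W1 P₁ Q : EReal) + ⨆ D ∈ F, ((((∫ x, D x ∂(P₂ : Measure S)) : ℝ) : EReal) -
        (((∫ x, D x ∂(Q : Measure S)) : ℝ) : EReal)))) =
      ⨆ D ∈ F, ((((∫ x, D x ∂(P₂ : Measure S)) : ℝ) : EReal) -
        (((∫ x, D x ∂(P₁ : Measure S)) : ℝ) : EReal)) := by
  have : CompactSpace S := isCompact_iff_compactSpace.mp hS
  apply le_antisymm
  · refine iInf_le_of_le P₁ ?_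
    rw [W1, OTCost_self (by simp)]
    simp
  · refine le_iInf fun Q => iSup₂_le fun D hD => ?_
    have hint (P : ProbabilityMeasure S) : Integrable D (P : Measure S) :=
      D.continuous.integrable_of_hasCompactSupport (HasCompactSupport.of_compactSpace _)
    have hle : ENNReal.ofReal ((∫ x, D x ∂(Q : Measure S)) - ∫ x, D x ∂(P₁ : Measure S)) ≤
        W1 P₁ Q := by
      refine ofReal_integral_sub_le_OTCost (fun x y => ?_) (hint P₁) (hint Q)
      have h := (hFlip D hD).dist_le_mul y x
      rwa [Real.dist_eq, NNReal.coe_one, one_mul, dist_comm y x, Subtype.dist_eq,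
        dist_eq_norm] at h
    have hW : (((∫ x, D x ∂(Q : Measure S)) - ∫ x, D x ∂(P₁ : Measure S) : ℝ) : EReal) ≤
        (W1 P₁ Q : EReal) := by
      refine le_trans ?_ (EReal.coe_ennreal_le_coe_ennreal_iff.mpr hle)
      rw [EReal.coe_ennreal_ofReal]
      exact EReal.coe_le_coe_iff.mpr (le_max_left _ _)
    refine le_trans (le_of_eq ?_) (add_le_add hW (le_iSup₂_of_le D hD le_rfl))
    norm_cast
    ring
end

section
/- Let X be a compact subset of a normed vector space and let f : (0,∞) → ℝ be convex and lower semicontinuous with f(1) = 0. Then for all Borel probability measures P0, P1, P2 on X: | d_{f,W1}(P0,P2) − d_{f,W1}(P1,P2) | ≤ W1(P0,P1). -/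
open MeasureTheory
open scoped ENNReal NNReal Classical

/-- The f-divergence `d_f(P,Q) := ∫ f(dQ/dP) dP` if `Q ≪ P` (and the integral exists),
and `+∞` otherwise. -/
noncomputable def fDiv {X : Type*} [MeasurableSpace X]
    (f : ℝ → ℝ) (P Q : ProbabilityMeasure X) : EReal :=
  if (Q : Measure X) ≪ (P : Measure X) ∧
      Integrable (fun x => f (((Q : Measure X).rnDeriv (P : Measure X) x).toReal))
        (P : Measure X)
  then ((∫ x, f (((Q : Measure X).rnDeriv (P : Measure X) x).toReal) ∂(P : Measure X) : ℝ) : EReal)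
  else ⊤

/-- Hybrid divergence `d_{f,W1}(P₁,P₂) := inf_Q ( W1(P₁,Q) + d_f(Q,P₂) )`. -/
noncomputable def dfW1 {E : Type*} [NormedAddCommGroup E] [MeasurableSpace E]
    {S : Set E} (f : ℝ → ℝ) (P₁ P₂ : ProbabilityMeasure S) : EReal :=
  ⨅ Q : ProbabilityMeasure S, (W1 P₁ Q : EReal) + fDiv f Q P₂

section OptimalTransport

open ProbabilityTheory

variable {X : Type*} [MeasurableSpace X]

theorem OTCost_le_lintegral (c : X → X → ℝ) {P Q : ProbabilityMeasure X}
    (M : ProbabilityMeasure (X × X))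
    (hfst : (M : Measure (X × X)).map Prod.fst = (P : Measure X))
    (hsnd : (M : Measure (X × X)).map Prod.snd = (Q : Measure X)) :
    OTCost c P Q ≤ ∫⁻ p, ENNReal.ofReal (c p.1 p.2) ∂(M : Measure (X × X)) :=
  iInf₂_le M ⟨hfst, hsnd⟩

theorem OTCost_comm {c : X → X → ℝ} (hc : Measurable (Function.uncurry c))
    (hsymm : ∀ x y, c x y = c y x) (P Q : ProbabilityMeasure X) :
    OTCost c P Q = OTCost c Q P := by
  have key : ∀ P Q : ProbabilityMeasure X, OTCost c P Q ≤ OTCost c Q P := by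
    intro P Q
    refine le_iInf₂ fun M hM => ?_
    have hs : Measurable (Prod.swap : X × X → X × X) := measurable_swap
    refine (OTCost_le_lintegral c (M.map hs.aemeasurable) ?_ ?_).trans_eq ?_
    · rw [ProbabilityMeasure.toMeasure_map, Measure.map_map measurable_fst hs]
      exact hM.2
    · rw [ProbabilityMeasure.toMeasure_map, Measure.map_map measurable_snd hs]
      exact hM.1
    · rw [ProbabilityMeasure.toMeasure_map,
        lintegral_map (f := fun p : X × X => ENNReal.ofReal (c p.1 p.2))
          (ENNReal.measurable_ofReal.comp hc) hs]
      exact lintegral_congr fun p => congrArg ENNReal.ofReal (hsymm _ _)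
  exact (key P Q).antisymm (key Q P)

/-- Two couplings sharing a marginal can be glued along it. -/
theorem exists_gluing [StandardBorelSpace X] [Nonempty X] (M N : Measure (X × X))
    [IsProbabilityMeasure M] [IsProbabilityMeasure N] (h : M.snd = N.fst) :
    ∃ G : Measure ((X × X) × X), IsProbabilityMeasure G ∧ G.map Prod.fst = M ∧
      G.map (fun p => (p.1.2, p.2)) = N := by
  refine ⟨M ⊗ₘ (N.condKernel.comap Prod.snd measurable_snd), inferInstance,
    Measure.fst_compProd _ _, ?_⟩
  have hm : Measurable (fun p : (X × X) × X => (p.1.2, p.2)) := by fun_prop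
  ext s hs
  rw [Measure.map_apply hm hs, Measure.compProd_apply (hm hs)]
  conv_rhs => rw [← N.disintegrate N.condKernel, Measure.compProd_apply hs, ← h, Measure.snd,
    lintegral_map (Kernel.measurable_kernel_prodMk_left hs) measurable_snd]
  rfl

theorem OTCost_triangle [StandardBorelSpace X] {c : X → X → ℝ}
    (hc : Measurable (Function.uncurry c)) (htri : ∀ x y z, c x z ≤ c x y + c y z)
    (P Q R : ProbabilityMeasure X) :
    OTCost c P R ≤ OTCost c P Q + OTCost c Q R := by
  have : Nonempty X := nonempty_of_isProbabilityMeasure (P : Measure X)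
  conv_rhs => simp only [OTCost]
  refine ENNReal.le_iInf₂_add_iInf₂ fun M hM N hN => ?_
  obtain ⟨G, hG, hGM, hGN⟩ := exists_gluing (M : Measure (X × X)) (N : Measure (X × X))
    (hM.2.trans hN.1.symm)
  have hm : Measurable (fun p : (X × X) × X => (p.1.1, p.2)) := by fun_prop
  have hm' : Measurable (fun p : (X × X) × X => (p.1.2, p.2)) := by fun_prop
  have hc' : Measurable (fun p : X × X => ENNReal.ofReal (c p.1 p.2)) :=
    ENNReal.measurable_ofReal.comp hc
  let G' : ProbabilityMeasure ((X × X) × X) := ⟨G, hG⟩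
  refine (OTCost_le_lintegral c (G'.map hm.aemeasurable) ?_ ?_).trans ?_
  · rw [ProbabilityMeasure.toMeasure_map, Measure.map_map measurable_fst hm, ← hM.1, ← hGM,
      Measure.map_map measurable_fst measurable_fst]
    rfl
  · rw [ProbabilityMeasure.toMeasure_map, Measure.map_map measurable_snd hm, ← hN.2, ← hGN,
      Measure.map_map measurable_snd hm']
    rfl
  · rw [ProbabilityMeasure.toMeasure_map, lintegral_map hc' hm, ← hGM, ← hGN,
      lintegral_map hc' measurable_fst, lintegral_map hc' hm']
    refine (lintegral_mono fun p => (ENNReal.ofReal_le_ofReal (htri _ p.1.2 _)).trans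
      ENNReal.ofReal_add_le).trans_eq (lintegral_add_left (hc'.comp measurable_fst) _)

theorem OTCost_ne_top_of_le {c : X → X → ℝ} {C : ℝ} (hC : ∀ x y, c x y ≤ C)
    (P Q : ProbabilityMeasure X) : OTCost c P Q ≠ ⊤ := by
  refine ne_top_of_le_ne_top ENNReal.ofReal_ne_top
    ((OTCost_le_lintegral c (P.prod Q) ?_ ?_).trans (c := ENNReal.ofReal C) ?_)
  · simp [ProbabilityMeasure.toMeasure_prod]
  · simp [ProbabilityMeasure.toMeasure_prod]
  · calc _ ≤ ∫⁻ _, ENNReal.ofReal C ∂((P.prod Q : ProbabilityMeasure (X × X)) :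
        Measure (X × X)) := lintegral_mono fun p => ENNReal.ofReal_le_ofReal (hC _ _)
      _ = ENNReal.ofReal C := by simp

theorem fDiv_self {f : ℝ → ℝ} (hf : f 1 = 0) (P : ProbabilityMeasure X) : fDiv f P P = 0 := by
  have h : (fun x => f (((P : Measure X).rnDeriv (P : Measure X) x).toReal))
      =ᵐ[(P : Measure X)] 0 := by
    filter_upwards [Measure.rnDeriv_self (P : Measure X)] with x hx
    simp [hx, hf]
  rw [fDiv, if_pos ⟨.rfl, (integrable_congr h).2 (integrable_zero _ _ _)⟩, integral_congr_ae h]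
  simp

/-- A function on the line which is convex on the positive half-line has an affine minorant on the
nonnegative half-line. -/
theorem ConvexOn.exists_affine_le_of_nonneg {f : ℝ → ℝ} (hf : ConvexOn ℝ (Set.Ioi 0) f) :
    ∃ a b : ℝ, ∀ x, 0 ≤ x → a * x + b ≤ f x := by
  have h1 : (1 : ℝ) ∈ interior (Set.Ioi 0) := by simp
  set a := derivWithin f (Set.Ioi 1) 1
  have hab : ∀ x, 0 < x → a * x + (f 1 - a) ≤ f x := by
    intro x hx
    rcases lt_trichotomy x 1 with hx1 | rfl | hx1
    · have h := (hf.slope_le_leftDeriv_of_mem_interior hx h1 hx1).trans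
        (hf.leftDeriv_le_rightDeriv_of_mem_interior h1)
      rw [slope_def_field, div_le_iff₀ (by linarith)] at h
      linarith
    · linarith
    · have h := hf.rightDeriv_le_slope_of_mem_interior h1 hx hx1
      rw [slope_def_field, le_div_iff₀ (by linarith)] at h
      linarith
  refine ⟨a, min (f 1 - a) (f 0), fun x hx => ?_⟩
  rcases hx.eq_or_lt with rfl | hx
  · simp
  · exact (by gcongr; exact min_le_left _ _ : _ ≤ a * x + (f 1 - a)).trans (hab x hx)

theorem exists_forall_le_fDiv {f : ℝ → ℝ} (hf : ConvexOn ℝ (Set.Ioi 0) f) :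
    ∃ C : ℝ, ∀ P Q : ProbabilityMeasure X, (C : EReal) ≤ fDiv f P Q := by
  obtain ⟨a, b, hab⟩ := hf.exists_affine_le_of_nonneg
  refine ⟨a + b, fun P Q => ?_⟩
  rw [fDiv]
  split_ifs with h
  · have hint : Integrable (fun x => ((Q : Measure X).rnDeriv (P : Measure X) x).toReal)
        (P : Measure X) := Measure.integrable_toReal_rnDeriv
    have hle := integral_mono ((hint.const_mul a).add (integrable_const b)) h.2
      fun x => hab _ ENNReal.toReal_nonneg
    simp only [Pi.add_apply] at hle
    rw [integral_add (hint.const_mul a) (integrable_const b), integral_const_mul,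
      Measure.integral_toReal_rnDeriv h.1] at hle
    exact_mod_cast (by simpa using hle)
  · exact le_top

end OptimalTransport

section Wasserstein

variable {E : Type*} [NormedAddCommGroup E] [MeasurableSpace E] {S : Set E}

theorem dfW1_ne_bot {f : ℝ → ℝ} (hf : ConvexOn ℝ (Set.Ioi 0) f) (P Q : ProbabilityMeasure S) :
    dfW1 f P Q ≠ ⊥ := by
  obtain ⟨C, hC⟩ := exists_forall_le_fDiv (X := S) hf
  refine ne_bot_of_le_ne_bot (EReal.coe_ne_bot C) (le_iInf fun R => ?_)
  simpa using add_le_add (EReal.coe_ennreal_nonneg (W1 P R)) (hC R Q)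

theorem W1_ne_top (hS : IsCompact S) (P Q : ProbabilityMeasure S) : W1 P Q ≠ ⊤ :=
  OTCost_ne_top_of_le (C := Metric.diam S) (fun x y => by
    rw [← dist_eq_norm]
    exact Metric.dist_le_diam_of_mem hS.isBounded x.2 y.2) P Q

theorem dfW1_ne_top (hS : IsCompact S) {f : ℝ → ℝ} (hf : f 1 = 0) (P Q : ProbabilityMeasure S) :
    dfW1 f P Q ≠ ⊤ := by
  refine ne_top_of_le_ne_top ?_ (iInf_le _ Q)
  rw [fDiv_self hf, add_zero]
  simpa using W1_ne_top hS P Q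

variable [BorelSpace E]

theorem measurable_norm_sub_subtype (hS : IsCompact S) :
    Measurable (Function.uncurry fun x x' : S => ‖(x : E) - (x' : E)‖) := by
  have : CompactSpace S := isCompact_iff_compactSpace.1 hS
  have : Continuous (Function.uncurry fun x x' : S => ‖(x : E) - (x' : E)‖) := by
    simp only [Function.uncurry_def]
    fun_prop
  exact this.measurable

theorem W1_comm (hS : IsCompact S) (P Q : ProbabilityMeasure S) : W1 P Q = W1 Q P :=
  OTCost_comm (measurable_norm_sub_subtype hS) (fun _ _ => norm_sub_rev _ _) P Q

theorem W1_triangle (hS : IsCompact S) (P Q R : ProbabilityMeasure S) :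
    W1 P R ≤ W1 P Q + W1 Q R := by
  have : CompactSpace S := isCompact_iff_compactSpace.1 hS
  exact OTCost_triangle (measurable_norm_sub_subtype hS)
    (fun _ _ _ => norm_sub_le_norm_sub_add_norm_sub _ _ _) P Q R

theorem dfW1_le_add (hS : IsCompact S) (f : ℝ → ℝ) (P Q R : ProbabilityMeasure S) :
    dfW1 f P R ≤ dfW1 f Q R + W1 P Q := by
  have htop : (W1 P Q : EReal) ≠ ⊤ := by simpa using W1_ne_top hS P Q
  have hbot : (W1 P Q : EReal) ≠ ⊥ := EReal.coe_ennreal_ne_bot _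
  rw [← EReal.sub_le_iff_le_add (.inl hbot) (.inl htop)]
  refine le_iInf fun T => ?_
  rw [EReal.sub_le_iff_le_add (.inl hbot) (.inl htop)]
  calc dfW1 f P R ≤ W1 P T + fDiv f T R := iInf_le _ T
    _ ≤ ((W1 P Q + W1 Q T : ℝ≥0∞) : EReal) + fDiv f T R := by
        gcongr
        exact EReal.coe_ennreal_le_coe_ennreal_iff.2 <| W1_triangle hS P Q T
    _ = W1 Q T + fDiv f T R + W1 P Q := by
        rw [EReal.coe_ennreal_add, add_comm (W1 P Q : EReal), add_right_comm]

end Wasserstein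

theorem stmt9 {E : Type*} [NormedAddCommGroup E] [NormedSpace ℝ E]
    [MeasurableSpace E] [BorelSpace E]
    (S : Set E) (hS : IsCompact S)
    (f : ℝ → ℝ) (hf_conv : ConvexOn ℝ (Set.Ioi 0) f)
    (hf_lsc : LowerSemicontinuousOn f (Set.Ioi 0)) (hf_one : f 1 = 0)
    (P₀ P₁ P₂ : ProbabilityMeasure S) :
    (dfW1 f P₀ P₂ - dfW1 f P₁ P₂).abs ≤ W1 P₀ P₁ := by
  obtain ⟨a, ha⟩ : ∃ a : ℝ, (a : EReal) = dfW1 f P₀ P₂ :=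
    ⟨_, EReal.coe_toReal (dfW1_ne_top hS hf_one _ _) (dfW1_ne_bot hf_conv _ _)⟩
  obtain ⟨b, hb⟩ : ∃ b : ℝ, (b : EReal) = dfW1 f P₁ P₂ :=
    ⟨_, EReal.coe_toReal (dfW1_ne_top hS hf_one _ _) (dfW1_ne_bot hf_conv _ _)⟩
  have h₁ := dfW1_le_add hS f P₀ P₁ P₂
  have h₂ := dfW1_le_add hS f P₁ P₀ P₂
  rw [W1_comm hS P₁ P₀] at h₂
  lift W1 P₀ P₁ to ℝ≥0 using W1_ne_top hS P₀ P₁ with w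
  rw [← ha, ← hb] at h₁ h₂ ⊢
  replace h₁ : a ≤ b + w := by exact EReal.coe_le_coe_iff.1 h₁
  replace h₂ : b ≤ a + w := by exact EReal.coe_le_coe_iff.1 h₂
  rw [← EReal.coe_sub, EReal.abs_def, ← ENNReal.ofReal_coe_nnreal]
  exact ENNReal.ofReal_le_ofReal (abs_sub_le_iff.2 ⟨by linarith, by linarith⟩)
end
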